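/- arXiv:1902.00412 — 2 statements merged into one kernel-verified Lean document; each statement's English description precedes it below -/
import Mathlib

section
/- (Lemma on contractions, part (iii): measure Lipschitz bound.) Assume the adaptive ABC setting with each Q_θ admitting a density bounded by C_Q uniformly in θ, and let 𝖡 ⊂ ℝ be compact with inf_{β∈𝖡} c_β > 0. Define π'_β(dθ,dθ') = c_β^{-1} pr(θ) L_β(θ) q(θ,θ') dθ dθ'. Then there exists a constant C > 0 such that for all β₁, β₂ ∈ 𝖡 and every bounded measurable g: T×T → ℝ, |π'_{β₁}(g) − π'_{β₂}(g)| ≤ C ‖g‖_∞ |e^{β₁} − e^{β₂}|. -/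
open MeasureTheory ProbabilityTheory
open scoped ENNReal

noncomputable section

namespace Adapt

variable {E : Type*} [MeasureSpace E]

/-- `L_β(θ) = Q_θ([0, e^β])`. -/
def Lb (Q : E → Measure ℝ) (β : ℝ) (θ : E) : ℝ :=
  (Q θ (Set.Icc 0 (Real.exp β))).toReal

/-- `c_β = ∫ pr(θ) L_β(θ) dθ`. -/
def cb (pr : E → ℝ) (Q : E → Measure ℝ) (β : ℝ) : ℝ :=
  ∫ θ, pr θ * Lb Q β θ

/-- `α̇(θ,ϑ) = min{1, pr(ϑ)q(ϑ,θ)/(pr(θ)q(θ,ϑ))}`. -/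
def alphadot (pr : E → ℝ) (q : E → E → ℝ) (θ ϑ : E) : ℝ :=
  min 1 (pr ϑ * q ϑ θ / (pr θ * q θ ϑ))

end Adapt

open Adapt

/-- `π'_β(g) = c_β⁻¹ ∫∫ pr(θ) L_β(θ) q(θ,θ') g(θ,θ') dθ' dθ`. -/
noncomputable def piPrime {E : Type*} [MeasureSpace E]
    (pr : E → ℝ) (q : E → E → ℝ) (Q : E → Measure ℝ) (β : ℝ)
    (g : E × E → ℝ) : ℝ :=
  (cb pr Q β)⁻¹ * ∫ θ, ∫ ϑ, pr θ * Lb Q β θ * q θ ϑ * g (θ, ϑ)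

section WeightedIntegrals

variable {E : Type*} [MeasurableSpace E] {μ : Measure E}

/-- A density times a bounded measurable function is integrable. -/
theorem integrable_mul_of_abs_le {f w : E → ℝ} (hf : Integrable f μ) (hw : AEStronglyMeasurable w μ)
    {K : ℝ} (hK : ∀ x, |w x| ≤ K) : Integrable (fun x => f x * w x) μ :=
  hf.mul_bdd (c := K) hw (Filter.Eventually.of_forall hK)

/-- A weighted average against a nonnegative weight is bounded by the sup of the integrand. -/
theorem abs_integral_mul_le {f w : E → ℝ} (hf : Integrable f μ) (hf0 : ∀ x, 0 ≤ f x)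
    {K : ℝ} (hK : ∀ x, |w x| ≤ K) : |∫ x, f x * w x ∂μ| ≤ K * ∫ x, f x ∂μ := by
  rw [← integral_const_mul, ← Real.norm_eq_abs]
  refine norm_integral_le_of_norm_le (hf.const_mul K) (Filter.Eventually.of_forall fun x => ?_)
  rw [Real.norm_eq_abs, abs_mul, abs_of_nonneg (hf0 x), mul_comm]
  exact mul_le_mul_of_nonneg_right (hK x) (hf0 x)

end WeightedIntegrals

/-- Lipschitz bound for quotients `I / c` with `|I₂| ≤ M c₂`. -/
theorem abs_inv_mul_sub_inv_mul_le {I₁ I₂ c₁ c₂ M δ m : ℝ} (hm : 0 < m) (hc₁ : m ≤ c₁)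
    (hc₂ : 0 < c₂) (hI : |I₁ - I₂| ≤ M * δ) (hc : |c₁ - c₂| ≤ δ) (hI₂ : |I₂| ≤ M * c₂)
    (hM : 0 ≤ M) : |c₁⁻¹ * I₁ - c₂⁻¹ * I₂| ≤ 2 * (M * δ) / m := by
  have hc₁' : 0 < c₁ := hm.trans_le hc₁
  have hδ : 0 ≤ δ := (abs_nonneg _).trans hc
  have key : c₁⁻¹ * I₁ - c₂⁻¹ * I₂ = ((I₁ - I₂) - I₂ / c₂ * (c₁ - c₂)) / c₁ := by
    field_simp
    ring
  have hquot : |I₂ / c₂| ≤ M := by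
    rwa [abs_div, abs_of_pos hc₂, div_le_iff₀ hc₂]
  have hnum : |(I₁ - I₂) - I₂ / c₂ * (c₁ - c₂)| ≤ 2 * (M * δ) := by
    have hprod : |I₂ / c₂ * (c₁ - c₂)| ≤ M * δ := by
      rw [abs_mul]
      exact mul_le_mul hquot hc (abs_nonneg _) hM
    linarith [abs_sub (I₁ - I₂) (I₂ / c₂ * (c₁ - c₂))]
  rw [key, abs_div, abs_of_pos hc₁']
  exact div_le_div₀ (by positivity) hnum hm hc₁

section Likelihood

variable {E : Type*}

theorem Lb_nonneg [MeasureSpace E] (Q : E → Measure ℝ) (β : ℝ) (θ : E) : 0 ≤ Lb Q β θ :=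
  ENNReal.toReal_nonneg

theorem abs_Lb_le_one [MeasureSpace E] (Q : E → Measure ℝ) (hQ : ∀ θ, IsProbabilityMeasure (Q θ))
    (β : ℝ) (θ : E) : |Lb Q β θ| ≤ 1 := by
  have := hQ θ
  rw [abs_of_nonneg (Lb_nonneg Q β θ)]
  exact measureReal_le_one

theorem measurable_Lb [MeasureSpace E] {Q : E → Measure ℝ} (hQ : Measurable Q) (β : ℝ) :
    Measurable (Lb Q β) :=
  ((Measure.measurable_coe measurableSet_Icc).comp hQ).ennreal_toReal

/-- A density bounded by `K` gives a distribution function that is `K`-Lipschitz. -/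
theorem abs_Lb_sub_le [MeasureSpace E] {Q : E → Measure ℝ} {Qd : E → ℝ → ℝ} {K : ℝ}
    (hQ : ∀ θ, IsProbabilityMeasure (Q θ)) (hK0 : 0 ≤ K) (hK : ∀ θ t, Qd θ t ≤ K)
    (hQd : ∀ θ, Q θ = volume.withDensity (fun t => ENNReal.ofReal (Qd θ t)))
    (β₁ β₂ : ℝ) (θ : E) :
    |Lb Q β₁ θ - Lb Q β₂ θ| ≤ K * |Real.exp β₁ - Real.exp β₂| := by
  have := hQ θ
  wlog h : β₁ ≤ β₂ generalizing β₁ β₂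
  · rw [abs_sub_comm, abs_sub_comm (Real.exp β₁)]
    exact this β₂ β₁ (le_of_not_ge h)
  have hexp : Real.exp β₁ ≤ Real.exp β₂ := Real.exp_le_exp.2 h
  have hmono : Lb Q β₁ θ ≤ Lb Q β₂ θ := measureReal_mono (Set.Icc_subset_Icc_right hexp)
  have hsplit : Lb Q β₂ θ ≤ Lb Q β₁ θ + (Q θ).real (Set.Ioc (Real.exp β₁) (Real.exp β₂)) := by
    change (Q θ).real _ ≤ (Q θ).real _ + _
    rw [← Set.Icc_union_Ioc_eq_Icc (Real.exp_pos β₁).le hexp]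
    exact measureReal_union_le _ _
  have hIoc : (Q θ).real (Set.Ioc (Real.exp β₁) (Real.exp β₂)) ≤
      K * (Real.exp β₂ - Real.exp β₁) := by
    refine ENNReal.toReal_le_of_le_ofReal (mul_nonneg hK0 (sub_nonneg.2 hexp)) ?_
    rw [hQd θ, withDensity_apply _ measurableSet_Ioc, ENNReal.ofReal_mul hK0, ← Real.volume_Ioc,
      ← setLIntegral_const]
    exact lintegral_mono fun t => ENNReal.ofReal_le_ofReal (hK θ t)
  rw [abs_sub_comm, abs_sub_comm (Real.exp β₁), abs_of_nonneg (sub_nonneg.2 hmono),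
    abs_of_nonneg (sub_nonneg.2 hexp)]
  linarith

end Likelihood

/-- Lemma on contractions, part (iii): measure Lipschitz bound. -/
theorem stmt12 (p : ℕ) (T : Set (Fin p → ℝ)) (hT_open : IsOpen T) (hT_ne : T.Nonempty)
    (pr : (Fin p → ℝ) → ℝ) (hpr_meas : Measurable pr) (hpr_nonneg : ∀ θ, 0 ≤ pr θ)
    (hpr_prob : ∫ θ, pr θ = 1)
    (Cpr : ℝ) (hpr_bdd : ∀ θ, pr θ ≤ Cpr)
    (hpr_supp : ∀ θ, θ ∉ T → pr θ = 0)
    (q : (Fin p → ℝ) → (Fin p → ℝ) → ℝ)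
    (hq_meas : Measurable (fun z : (Fin p → ℝ) × (Fin p → ℝ) => q z.1 z.2))
    (hq_nonneg : ∀ θ ϑ, 0 ≤ q θ ϑ)
    (Cq : ℝ) (hq_bdd : ∀ θ ϑ, q θ ϑ ≤ Cq)
    (hq_prob : ∀ θ, ∫ ϑ, q θ ϑ = 1)
    (Q : (Fin p → ℝ) → Measure ℝ) (hQ_meas : Measurable Q)
    (hQ_prob : ∀ θ, IsProbabilityMeasure (Q θ))
    (hQ_supp : ∀ θ, Q θ (Set.Iio 0) = 0)
    (Qd : (Fin p → ℝ) → ℝ → ℝ) (CQ : ℝ)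
    (hQd_nonneg : ∀ θ t, 0 ≤ Qd θ t) (hQd_bdd : ∀ θ t, Qd θ t ≤ CQ)
    (hQd : ∀ θ, Q θ = volume.withDensity (fun t => ENNReal.ofReal (Qd θ t)))
    -- compact tolerance set with `inf_{β ∈ B} c_β > 0`
    (B : Set ℝ) (hB : IsCompact B)
    (cmin : ℝ) (hcmin : 0 < cmin) (hcb : ∀ β ∈ B, cmin ≤ cb pr Q β) :
    ∃ C : ℝ, 0 < C ∧
      ∀ β₁ ∈ B, ∀ β₂ ∈ B,
        ∀ g : (Fin p → ℝ) × (Fin p → ℝ) → ℝ, Measurable g →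
        ∀ M : ℝ, (∀ z, |g z| ≤ M) →
          |piPrime pr q Q β₁ g - piPrime pr q Q β₂ g|
            ≤ C * M * |Real.exp β₁ - Real.exp β₂| := by
  have hCQ : 0 ≤ CQ := (hQd_nonneg 0 0).trans (hQd_bdd 0 0)
  have hpr : Integrable pr := Integrable.of_integral_ne_zero (by simp [hpr_prob])
  have hq : ∀ θ, Integrable (q θ) := fun θ =>
    Integrable.of_integral_ne_zero (by simp [hq_prob θ])
  have hprL : ∀ β, Integrable (fun θ => pr θ * Lb Q β θ) := fun β =>
    integrable_mul_of_abs_le hpr (measurable_Lb hQ_meas β).aestronglyMeasurable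
      (abs_Lb_le_one Q hQ_prob β)
  refine ⟨2 * CQ / cmin + 1, by positivity, fun β₁ hβ₁ β₂ hβ₂ g hg M hM => ?_⟩
  have hM0 : 0 ≤ M := (abs_nonneg _).trans (hM 0)
  set d := |Real.exp β₁ - Real.exp β₂|
  have hd : 0 ≤ d := abs_nonneg _
  set G : (Fin p → ℝ) → ℝ := fun θ => ∫ ϑ, q θ ϑ * g (θ, ϑ)
  have hG_meas : AEStronglyMeasurable G :=
    (hq_meas.mul hg).stronglyMeasurable.integral_prod_right'.aestronglyMeasurable
  have hG : ∀ θ, |G θ| ≤ M := fun θ => by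
    simpa [hq_prob θ] using
      abs_integral_mul_le (hq θ) (hq_nonneg θ) (fun ϑ => hM (θ, ϑ))
  have hpi : ∀ β, piPrime pr q Q β g = (cb pr Q β)⁻¹ * ∫ θ, pr θ * Lb Q β θ * G θ := fun β => by
    simp only [piPrime, G, ← integral_const_mul, mul_assoc]
  have hL := abs_Lb_sub_le hQ_prob hCQ hQd_bdd hQd β₁ β₂
  have hc : |cb pr Q β₁ - cb pr Q β₂| ≤ CQ * d := by
    rw [cb, cb, ← integral_sub (hprL β₁) (hprL β₂)]
    simpa only [← mul_sub, hpr_prob, mul_one] using abs_integral_mul_le hpr hpr_nonneg hL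
  have hI : |(∫ θ, pr θ * Lb Q β₁ θ * G θ) - ∫ θ, pr θ * Lb Q β₂ θ * G θ| ≤ M * (CQ * d) := by
    rw [← integral_sub (integrable_mul_of_abs_le (hprL β₁) hG_meas hG)
      (integrable_mul_of_abs_le (hprL β₂) hG_meas hG)]
    have hbound : ∀ θ, |(Lb Q β₁ θ - Lb Q β₂ θ) * G θ| ≤ M * (CQ * d) := fun θ => by
      rw [abs_mul, mul_comm]
      exact mul_le_mul (hG θ) (hL θ) (abs_nonneg _) hM0
    simpa only [← mul_sub, ← sub_mul, mul_assoc, hpr_prob, mul_one] using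
      abs_integral_mul_le hpr hpr_nonneg hbound
  have hI₂ : |∫ θ, pr θ * Lb Q β₂ θ * G θ| ≤ M * cb pr Q β₂ :=
    abs_integral_mul_le (hprL β₂) (fun θ => mul_nonneg (hpr_nonneg θ) (Lb_nonneg Q β₂ θ)) hG
  rw [hpi, hpi]
  calc _ ≤ 2 * (M * (CQ * d)) / cmin :=
        abs_inv_mul_sub_inv_mul_le hcmin (hcb β₁ hβ₁) (hcmin.trans_le (hcb β₂ hβ₂)) hI hc hI₂ hM0
    _ = 2 * CQ / cmin * M * d := by ring
    _ ≤ (2 * CQ / cmin + 1) * M * d := by gcongr; linarith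
end
end

section
/- (Doeblin minorization implies uniform geometric ergodicity.) Let P be a Markov kernel on a measurable space (X,𝒳) with invariant probability measure μ, and suppose there is δ ∈ (0,1] such that P(x,A) ≥ δ μ(A) for every x ∈ X and every measurable A ⊆ X. Then for every bounded measurable f: X → ℝ, every x ∈ X and every k ≥ 1, |P^k f(x) − μ(f)| ≤ 2 (1 − δ)^k ‖f‖_∞. -/
open MeasureTheory ProbabilityTheory
open scoped ENNReal

noncomputable section

/-- `k`-step transition kernel: `kpow κ 0 = id`, `kpow κ (k+1) = κ ∘ₖ kpow κ k`. -/
def kpow {X : Type*} [MeasurableSpace X] (κ : Kernel X X) : ℕ → Kernel X X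
  | 0 => Kernel.id
  | n + 1 => κ ∘ₖ kpow κ n

instance isMarkovKernel_kpow {X : Type*} [MeasurableSpace X] (κ : Kernel X X)
    [IsMarkovKernel κ] (n : ℕ) : IsMarkovKernel (kpow κ n) := by
  induction n with
  | zero => exact inferInstanceAs (IsMarkovKernel Kernel.id)
  | succ n ih => exact inferInstanceAs (IsMarkovKernel (κ ∘ₖ kpow κ n))

lemma integrable_of_abs_le {X : Type*} [MeasurableSpace X] (ν : Measure X) [IsFiniteMeasure ν]
    {g : X → ℝ} (hg : Measurable g) {C : ℝ} (hC : ∀ x, |g x| ≤ C) : Integrable g ν :=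
  .of_bound hg.aestronglyMeasurable C (.of_forall hC)

/-- A probability measure dominating `δ • μ` integrates a `μ`-centred function bounded above
by `C` to at most `(1 - δ) * C`. -/
lemma integral_le_of_smul_le {X : Type*} [MeasurableSpace X] {μ ν : Measure X}
    [IsProbabilityMeasure μ] [IsProbabilityMeasure ν] {δ : ℝ} (hδ : 0 ≤ δ)
    (hle : ENNReal.ofReal δ • μ ≤ ν) {g : X → ℝ} {C : ℝ} (hC : ∀ x, g x ≤ C)
    (hgμ : Integrable g μ) (hgν : Integrable g ν) (h0 : ∫ x, g x ∂μ = 0) :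
    ∫ x, g x ∂ν ≤ (1 - δ) * C := by
  have h := integral_mono_measure (f := fun x => C - g x) hle
    (.of_forall fun x => sub_nonneg.2 (hC x)) ((integrable_const C).sub hgν)
  rw [integral_smul_measure, ENNReal.toReal_ofReal hδ,
    integral_sub (integrable_const C) hgμ, integral_sub (integrable_const C) hgν, h0] at h
  simp only [integral_const, probReal_univ, smul_eq_mul, sub_zero] at h
  linarith

lemma abs_integral_le_of_smul_le {X : Type*} [MeasurableSpace X] {μ ν : Measure X}
    [IsProbabilityMeasure μ] [IsProbabilityMeasure ν] {δ : ℝ} (hδ : 0 ≤ δ)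
    (hle : ENNReal.ofReal δ • μ ≤ ν) {g : X → ℝ} (hg : Measurable g) {C : ℝ}
    (hC : ∀ x, |g x| ≤ C) (h0 : ∫ x, g x ∂μ = 0) :
    |∫ x, g x ∂ν| ≤ (1 - δ) * C := by
  have hgμ := integrable_of_abs_le μ hg hC
  have hgν := integrable_of_abs_le ν hg hC
  refine abs_le'.2 ⟨integral_le_of_smul_le hδ hle (fun x => (abs_le'.1 (hC x)).1) hgμ hgν h0, ?_⟩
  rw [← integral_neg]
  exact integral_le_of_smul_le hδ hle (fun x => (abs_le'.1 (hC x)).2) hgμ.neg hgν.neg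
    (by rw [integral_neg, h0, neg_zero])

/-- Under a Doeblin minorization, the iterates of the kernel contract centred bounded functions
geometrically. -/
lemma abs_integral_kpow_le {X : Type*} [MeasurableSpace X] (P : Kernel X X) [IsMarkovKernel P]
    {μ : Measure X} [IsProbabilityMeasure μ] (hinv : μ.bind P = μ) {δ : ℝ} (hδ : 0 ≤ δ)
    (hle : ∀ x, ENNReal.ofReal δ • μ ≤ P x) (k : ℕ) {g : X → ℝ} (hg : Measurable g) {C : ℝ}
    (hC : ∀ x, |g x| ≤ C) (h0 : ∫ x, g x ∂μ = 0) (x : X) :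
    |∫ y, g y ∂(kpow P k x)| ≤ (1 - δ) ^ k * C := by
  induction k generalizing g C with
  | zero => simpa [kpow, Kernel.id_apply, integral_dirac' g x hg.stronglyMeasurable] using hC x
  | succ k ih =>
    have hbind : ∫ y, g y ∂(kpow P (k + 1) x) = ∫ y, ∫ z, g z ∂(P y) ∂(kpow P k x) :=
      Kernel.integral_comp (integrable_of_abs_le (kpow P (k + 1) x) hg hC)
    have hmean : ∫ y, ∫ z, g z ∂(P y) ∂μ = 0 := by
      have hcomp : (P ∘ₖ Kernel.const Unit μ) () = μ := by
        rw [Kernel.comp_apply, Kernel.const_apply, hinv]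
      have h := Kernel.integral_comp (κ := Kernel.const Unit μ) (η := P) (a := ())
        (integrable_of_abs_le _ hg hC)
      rwa [hcomp, h0, Kernel.const_apply, eq_comm] at h
    have h := ih hg.stronglyMeasurable.integral_kernel.measurable
      (fun y => abs_integral_le_of_smul_le hδ (hle y) hg hC h0) hmean
    rwa [hbind, pow_succ, mul_assoc]

/-- a Doeblin minorization `P(x,·) ≥ δ μ(·)` implies uniform geometric
ergodicity: `|P^k f(x) - μ(f)| ≤ 2 (1-δ)^k ‖f‖_∞`. -/
theorem stmt16 {X : Type*} [MeasurableSpace X]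
    (P : Kernel X X) [IsMarkovKernel P]
    (μ : Measure X) [IsProbabilityMeasure μ] (hinv : μ.bind P = μ)
    (δ : ℝ) (hδ : δ ∈ Set.Ioc (0 : ℝ) 1)
    (hmin : ∀ x : X, ∀ A : Set X, MeasurableSet A → ENNReal.ofReal δ * μ A ≤ P x A) :
    ∀ f : X → ℝ, Measurable f → ∀ M : ℝ, (∀ x, |f x| ≤ M) →
      ∀ x : X, ∀ k : ℕ, 1 ≤ k →
        |(∫ y, f y ∂(kpow P k x)) - ∫ y, f y ∂μ| ≤ 2 * (1 - δ) ^ k * M := by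
  intro f hf M hM x k _
  have hle (y : X) : ENNReal.ofReal δ • μ ≤ P y := Measure.le_iff.2 (hmin y)
  have hfμ := integrable_of_abs_le μ hf hM
  have hmean : |∫ y, f y ∂μ| ≤ M := by
    simpa using norm_integral_le_of_norm_le_const (μ := μ) (f := f) (.of_forall hM)
  have h := abs_integral_kpow_le P hinv hδ.1.le hle k (g := fun y => f y - ∫ z, f z ∂μ)
    (C := 2 * M) (hf.sub_const _)
    (fun y => (abs_sub _ _).trans (by linarith [hM y]))
    (by rw [integral_sub hfμ (integrable_const _)]; simp) x
  rw [integral_sub (integrable_of_abs_le _ hf hM) (integrable_const _)] at h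
  simp only [integral_const, probReal_univ, one_smul] at h
  linarith
end
end
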